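/- (Log-determinant guarantee for QR pivot sensors.) Let Ψ ∈ ℝ^{n×r} and C ∈ ℝ^{p×n} with r ≤ p, and suppose U := C Ψ ∈ ℝ^{p×r} has full column rank. Suppose Uᵀ admits a pivoted QR factorization Uᵀ P = Q R, where P is a p×p permutation matrix, Q ∈ ℝ^{r×r} is orthogonal, and R ∈ ℝ^{r×p} is upper triangular satisfying the Businger–Golub diagonal dominance property. Let S ∈ ℝ^{r×p} be the row-selection matrix formed by transposing the first r columns of P, and set Ĉ := S C. Let Σ_r = diag(σ₁, …, σ_r) with all σᵢ > 0 and Ŵ_c := Ψ Σ_r Ψᵀ. Then r · log( 9 σ_min(CΨ)² / ((p − r + 1)(4^r + 6r − 1)) ) + Σ_{i=1}^{r} log σᵢ ≤ log det( Ĉ Ŵ_c Ĉᵀ ). -/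

import Mathlib

open Matrix

/-- Euclidean norm of a vector in ℝⁿ. -/
noncomputable def euclNorm {n : ℕ} (x : Fin n → ℝ) : ℝ :=
  ‖(EuclideanSpace.equiv (Fin n) ℝ).symm x‖

/-- Smallest singular value of a matrix: the infimum of `‖Ux‖₂` over the unit sphere. -/
noncomputable def sigmaMin {p r : ℕ} (U : Matrix (Fin p) (Fin r) ℝ) : ℝ :=
  sInf {c : ℝ | ∃ x : Fin r → ℝ, euclNorm x = 1 ∧ c = euclNorm (U.mulVec x)}

/-- A permutation matrix: exactly one entry 1 in each row and column, zeros elsewhere. -/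
def IsPermMatrix {p : ℕ} (P : Matrix (Fin p) (Fin p) ℝ) : Prop :=
  ∃ σ : Equiv.Perm (Fin p), P = σ.permMatrix ℝ

/-- Upper triangular (possibly rectangular) matrix: `R j k = 0` for `j > k`. -/
def IsUpperTri {r p : ℕ} (R : Matrix (Fin r) (Fin p) ℝ) : Prop :=
  ∀ (j : Fin r) (k : Fin p), (k : ℕ) < (j : ℕ) → R j k = 0

/-- Businger–Golub diagonal dominance:
`|R i i|² ≥ Σ_{j=i}^{min(k,r)} |R j k|²` for all `i ≤ k`. -/
def BusingerGolub {r p : ℕ} (R : Matrix (Fin r) (Fin p) ℝ) : Prop :=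
  ∀ (i : Fin r) (ip : Fin p) (k : Fin p), (i : ℕ) = (ip : ℕ) → (ip : ℕ) ≤ (k : ℕ) →
    (∑ j : Fin r, if (i : ℕ) ≤ (j : ℕ) ∧ (j : ℕ) ≤ (k : ℕ) then (R j k) ^ 2 else 0)
      ≤ (R i ip) ^ 2

lemma euclNorm_sq {n : ℕ} (x : Fin n → ℝ) : euclNorm x ^ 2 = x ⬝ᵥ x := by
  refine (EuclideanSpace.norm_sq_eq _).trans ?_
  simp [dotProduct, pow_two]

lemma euclNorm_nonneg {n : ℕ} (x : Fin n → ℝ) : 0 ≤ euclNorm x := norm_nonneg _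

lemma sigmaMin_le {p r : ℕ} (U : Matrix (Fin p) (Fin r) ℝ) {x : Fin r → ℝ}
    (hx : euclNorm x = 1) : sigmaMin U ≤ euclNorm (U.mulVec x) := by
  refine csInf_le ⟨0, ?_⟩ ⟨x, hx, rfl⟩
  rintro _ ⟨y, -, rfl⟩
  exact euclNorm_nonneg _

lemma sigmaMin_nonneg {p r : ℕ} (U : Matrix (Fin p) (Fin r) ℝ) : 0 ≤ sigmaMin U := by
  refine Real.sInf_nonneg ?_
  rintro _ ⟨y, -, rfl⟩
  exact euclNorm_nonneg _

/-- A matrix with at least one column and full column rank has positive smallest singular value. -/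
lemma sigmaMin_pos {p r : ℕ} (hr : 1 ≤ r) (U : Matrix (Fin p) (Fin r) ℝ) (hU : U.rank = r) :
    0 < sigmaMin U := by
  have hinj : Function.Injective U.mulVec := by
    rw [mulVec_injective_iff]
    exact linearIndependent_iff_card_eq_finrank_span.mpr (by
      rw [Fintype.card_fin, Set.finrank, ← rank_eq_finrank_span_cols, hU])
  let L : EuclideanSpace ℝ (Fin r) →ₗ[ℝ] EuclideanSpace ℝ (Fin p) := toLpLin 2 2 U
  have hL : LinearMap.ker L = ⊥ := by
    rw [LinearMap.ker_eq_bot]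
    intro x y h
    have h' := congrArg WithLp.ofLp h
    exact WithLp.ofLp_injective 2 (hinj (by simpa [L] using h'))
  obtain ⟨K, hK, hanti⟩ := L.exists_antilipschitzWith hL
  have hK' : (0 : ℝ) < K := hK
  refine lt_of_lt_of_le (inv_pos.mpr hK') (le_csInf ?_ ?_)
  · refine ⟨_, Pi.single ⟨0, hr⟩ 1, ?_, rfl⟩
    have h := euclNorm_sq (Pi.single (⟨0, hr⟩ : Fin r) (1 : ℝ))
    simp only [dotProduct_single, Pi.single_eq_same, mul_one] at h
    exact (pow_eq_one_iff_of_nonneg (euclNorm_nonneg _) two_ne_zero).mp h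
  · rintro _ ⟨x, hx, rfl⟩
    have h := hanti.le_mul_dist (WithLp.toLp 2 x) 0
    rw [map_zero, dist_zero_right, dist_zero_right] at h
    change euclNorm x ≤ K * euclNorm (U.mulVec x) at h
    rw [hx] at h
    rwa [inv_le_iff_one_le_mul₀' hK']

/-- Entries of the trailing block are dominated by the diagonal entry at its corner. -/
lemma BusingerGolub.sq_le {r p : ℕ} {R : Matrix (Fin r) (Fin p) ℝ} (hR : BusingerGolub R)
    {i j : Fin r} {ip k : Fin p} (hi : (i : ℕ) = ip) (hij : i ≤ j) (hjk : (j : ℕ) ≤ k) :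
    R j k ^ 2 ≤ R i ip ^ 2 := by
  have hij' : (i : ℕ) ≤ j := hij
  refine le_trans ?_ (hR i ip k hi (by omega))
  have h := Finset.single_le_sum
    (f := fun j : Fin r => if (i : ℕ) ≤ (j : ℕ) ∧ (j : ℕ) ≤ (k : ℕ) then (R j k) ^ 2 else 0)
    (fun j _ => by positivity) (Finset.mem_univ j)
  simpa only [hij', hjk, and_self, if_true] using h

lemma IsPermMatrix.mul_transpose {p : ℕ} {P : Matrix (Fin p) (Fin p) ℝ} (hP : IsPermMatrix P) :
    P * Pᵀ = 1 := by
  obtain ⟨σ, rfl⟩ := hP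
  rw [transpose_permMatrix, ← permMatrix_mul]
  simp

/-- In a pivoted QR factorization of `Uᵀ`, the smallest singular value of `U` is at most the norm
of any row of `R`. -/
lemma sigmaMin_sq_le_row {p r : ℕ} {U : Matrix (Fin p) (Fin r) ℝ}
    {P : Matrix (Fin p) (Fin p) ℝ} (hP : IsPermMatrix P)
    {Q : Matrix (Fin r) (Fin r) ℝ} (hQ : Qᵀ * Q = 1) {R : Matrix (Fin r) (Fin p) ℝ}
    (hQR : Uᵀ * P = Q * R) (i : Fin r) :
    sigmaMin U ^ 2 ≤ ∑ k, R i k ^ 2 := by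
  have hUU : Qᵀ * (Uᵀ * U) * Q = R * Rᵀ := by
    have h : Uᵀ * U = (Uᵀ * P) * (Uᵀ * P)ᵀ := by
      rw [transpose_mul, transpose_transpose, Matrix.mul_assoc, ← Matrix.mul_assoc P,
        hP.mul_transpose, Matrix.one_mul]
    rw [h, hQR, transpose_mul]
    calc Qᵀ * (Q * R * (Rᵀ * Qᵀ)) * Q = (Qᵀ * Q) * (R * Rᵀ) * (Qᵀ * Q) := by
          simp only [Matrix.mul_assoc]
      _ = R * Rᵀ := by rw [hQ, Matrix.one_mul, Matrix.mul_one]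
  have hunit : euclNorm (Q.col i) = 1 := by
    have h := euclNorm_sq (Q.col i)
    have h' := congrFun (congrFun hQ i) i
    rw [one_apply_eq] at h'
    change Q.col i ⬝ᵥ Q.col i = 1 at h'
    rw [h'] at h
    exact (pow_eq_one_iff_of_nonneg (euclNorm_nonneg _) two_ne_zero).mp h
  calc sigmaMin U ^ 2 ≤ euclNorm (U.mulVec (Q.col i)) ^ 2 :=
        pow_le_pow_left₀ (sigmaMin_nonneg U) (sigmaMin_le U hunit) 2
    _ = ((U * Q)ᵀ * (U * Q)) i i := euclNorm_sq _
    _ = (R * Rᵀ) i i := by rw [← hUU, transpose_mul]; simp only [Matrix.mul_assoc]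
    _ = ∑ k, R i k ^ 2 := by simp [mul_apply, pow_two]

/-- A row of an upper-triangular matrix with the Businger–Golub property is controlled by its
diagonal entry. -/
lemma BusingerGolub.row_le {r p : ℕ} {R : Matrix (Fin r) (Fin p) ℝ} (hR : BusingerGolub R)
    (hRtri : IsUpperTri R) {i : Fin r} {ip : Fin p} (hi : (i : ℕ) = ip) :
    ∑ k, R i k ^ 2 ≤ ((p : ℝ) - i) * R i ip ^ 2 := by
  calc ∑ k, R i k ^ 2 ≤ ∑ k, if ip ≤ k then R i ip ^ 2 else 0 := by
        refine Finset.sum_le_sum fun k _ => ?_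
        split_ifs with h
        · exact hR.sq_le hi le_rfl (hi ▸ h)
        · rw [hRtri i k (by rw [hi]; exact not_le.mp h)]
          norm_num
    _ = ((p : ℝ) - i) * R i ip ^ 2 := by
        rw [← Finset.sum_filter, Finset.sum_const, nsmul_eq_mul]
        have : (Finset.univ.filter fun k => ip ≤ k) = Finset.Ici ip := by ext; simp
        rw [this, Fin.card_Ici, Nat.cast_sub ip.is_lt.le, hi]

lemma nine_le_four_pow_add {r : ℕ} (hr : 1 ≤ r) : (9 : ℝ) ≤ 4 ^ r + 6 * r - 1 := by
  have h₁ : (4 : ℝ) ^ 1 ≤ 4 ^ r := pow_le_pow_right₀ (by norm_num) hr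
  have h₂ : (1 : ℝ) ≤ r := by exact_mod_cast hr
  linarith

/-- The squared determinant of the selected rows of `U` is the product of the squared diagonal
entries of `R`. -/
lemma det_selected_sq {p r : ℕ} (hrp : r ≤ p) {U : Matrix (Fin p) (Fin r) ℝ}
    {P : Matrix (Fin p) (Fin p) ℝ} {Q : Matrix (Fin r) (Fin r) ℝ} (hQ : Qᵀ * Q = 1)
    {R : Matrix (Fin r) (Fin p) ℝ} (hRtri : IsUpperTri R) (hQR : Uᵀ * P = Q * R) :
    (((Matrix.of fun (i : Fin r) (j : Fin p) => P j (Fin.castLE hrp i)) * U).det) ^ 2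
      = ∏ i, R i (Fin.castLE hrp i) ^ 2 := by
  have hT : ((Matrix.of fun (i : Fin r) (j : Fin p) => P j (Fin.castLE hrp i)) * U)ᵀ
      = Q * R.submatrix id (Fin.castLE hrp) := by
    rw [transpose_mul]
    exact congrArg (fun M => M.submatrix id (Fin.castLE hrp)) hQR
  have hQdet : Q.det ^ 2 = 1 := by
    simpa [pow_two] using congrArg det hQ
  have hupper : (R.submatrix id (Fin.castLE hrp)).BlockTriangular id :=
    fun i j hij => hRtri i (Fin.castLE hrp j) hij
  rw [← det_transpose, hT, det_mul, mul_pow, hQdet, one_mul, det_of_isUpperTriangular hupper,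
    ← Finset.prod_pow]
  rfl

/-- Log-determinant guarantee for QR pivot sensors. -/
theorem logdet_guarantee_sensors {n p r : ℕ} (hr : 1 ≤ r) (hrp : r ≤ p)
    (Ψ : Matrix (Fin n) (Fin r) ℝ) (C : Matrix (Fin p) (Fin n) ℝ)
    (hrank : (C * Ψ).rank = r)
    (P : Matrix (Fin p) (Fin p) ℝ) (hP : IsPermMatrix P)
    (Q : Matrix (Fin r) (Fin r) ℝ) (hQ : Qᵀ * Q = 1)
    (R : Matrix (Fin r) (Fin p) ℝ) (hRtri : IsUpperTri R) (hRbg : BusingerGolub R)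
    (hQR : (C * Ψ)ᵀ * P = Q * R)
    (S : Matrix (Fin r) (Fin p) ℝ)
    (hS : S = Matrix.of fun (i : Fin r) (j : Fin p) => P j (Fin.castLE hrp i))
    (Chat : Matrix (Fin r) (Fin n) ℝ) (hChat : Chat = S * C)
    (σ : Fin r → ℝ) (hσ : ∀ i, 0 < σ i)
    (Wc : Matrix (Fin n) (Fin n) ℝ) (hWc : Wc = Ψ * Matrix.diagonal σ * Ψᵀ) :
    (r : ℝ) * Real.log (9 * sigmaMin (C * Ψ) ^ 2 /
          (((p : ℝ) - r + 1) * ((4 : ℝ) ^ r + 6 * r - 1)))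
        + ∑ i, Real.log (σ i)
      ≤ Real.log (Chat * Wc * Chatᵀ).det := by
  have hlast : r - 1 < r := by omega
  let l : Fin r := ⟨r - 1, hlast⟩
  have hcast : ((l : ℕ) : ℝ) = r - 1 := by simp [l, Nat.cast_sub hr]
  set s := sigmaMin (C * Ψ) with hs
  have hspos : 0 < s := sigmaMin_pos hr _ hrank
  have hm : (0 : ℝ) < p - r + 1 := by
    have : (r : ℝ) ≤ p := by exact_mod_cast hrp
    linarith
  have hN := nine_le_four_pow_add hr
  set a : ℝ := 9 * s ^ 2 / (((p : ℝ) - r + 1) * ((4 : ℝ) ^ r + 6 * r - 1)) with ha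
  have hapos : 0 < a := by
    have : (0 : ℝ) < 4 ^ r + 6 * r - 1 := by linarith
    positivity
  have hal : a ≤ R l (Fin.castLE hrp l) ^ 2 := by
    have h := (sigmaMin_sq_le_row hP hQ hQR l).trans
      (hRbg.row_le hRtri (ip := Fin.castLE hrp l) rfl)
    rw [hcast, ← hs] at h
    rw [ha, div_le_iff₀ (mul_pos hm (by linarith))]
    nlinarith [mul_le_mul_of_nonneg_left hN
      (mul_nonneg hm.le (sq_nonneg (R l (Fin.castLE hrp l))))]
  have hai (i : Fin r) : a ≤ R i (Fin.castLE hrp i) ^ 2 :=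
    hal.trans (hRbg.sq_le rfl (Fin.le_def.mpr (Nat.le_sub_one_of_lt i.is_lt)) le_rfl)
  have hdet : (Chat * Wc * Chatᵀ).det = (∏ i, R i (Fin.castLE hrp i) ^ 2) * ∏ i, σ i := by
    have h : Chat * Wc * Chatᵀ = (S * (C * Ψ)) * diagonal σ * (S * (C * Ψ))ᵀ := by
      rw [hChat, hWc]
      simp only [transpose_mul, Matrix.mul_assoc]
    rw [h, det_mul, det_mul, det_transpose, det_diagonal, hS,
      ← det_selected_sq hrp hQ hRtri hQR]
    ring
  have hprod : 0 < ∏ i, σ i := Finset.prod_pos fun i _ => hσ i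
  have hpow : a ^ r ≤ ∏ i, R i (Fin.castLE hrp i) ^ 2 := by
    simpa using Finset.prod_le_prod (s := Finset.univ) (fun _ _ => hapos.le) fun i _ => hai i
  rw [hdet, ← Real.log_pow, ← Real.log_prod fun i _ => (hσ i).ne',
    ← Real.log_mul (by positivity) hprod.ne']
  exact Real.log_le_log (by positivity) (mul_le_mul_of_nonneg_right hpow hprod.le)
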